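/- Trace Distance Properties: given term distributions T, S with δ^T(T, S) = d: (i) if T ⇛ T' then δ^T(T', S) = d; (ii) if T ↦^{pass(v)} T' and S ↦^{pass(v)} S' then δ^T(T', S') ≤ d; (iii) if T ↦^{view(M)} p₁ and S ↦^{view(M)} p₂ then |p₁ − p₂| ≤ d. -/

import Mathlib

set_option autoImplicit false
set_option maxHeartbeats 1000000

open scoped Classical ENNReal

/-! ### Syntax of RSLR -/

/-- Binary strings. -/
abbrev BStr := List Bool

/-- Aspects. -/
inductive Aspect : Type
  | box | bbox
deriving DecidableEq

/-- Types of RSLR: `Str` and aspect-annotated arrows. -/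
inductive Ty : Type
  | str : Ty
  | arrow : Aspect → Ty → Ty → Ty
deriving DecidableEq

/-- The order on aspects: `□ <: □`, `□ <: ■`, `■ <: ■`. -/
inductive AspectLe : Aspect → Aspect → Prop
  | boxBox : AspectLe .box .box
  | boxBBox : AspectLe .box .bbox
  | bboxBBox : AspectLe .bbox .bbox

/-- Subtyping of RSLR types. -/
inductive SubTy : Ty → Ty → Prop
  | refl (A : Ty) : SubTy A A
  | trans {A B C : Ty} : SubTy A B → SubTy B C → SubTy A C
  | arrow {A B C D : Ty} {a b : Aspect} :
      SubTy B A → SubTy C D → AspectLe a b → SubTy (.arrow a A C) (.arrow b B D)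

/-- A type is `□`-free when no `□` aspect occurs in it. -/
def Ty.boxFree : Ty → Prop
  | .str => True
  | .arrow a A B => a = .bbox ∧ A.boxFree ∧ B.boxFree

/-- Terms of RSLR. -/
inductive Tm : Type
  | var : ℕ → Tm
  | str : BStr → Tm
  | lam : ℕ → Aspect → Ty → Tm → Tm
  | app : Tm → Tm → Tm
  | zero : Tm → Tm
  | one : Tm → Tm
  | tail : Tm → Tm
  | tcase : Ty → Tm → Tm → Tm → Tm → Tm
  | trec : Ty → Tm → Tm → Tm → Tm → Tm
  | rand : Tm
deriving DecidableEq

/-- Values: string constants and abstractions. -/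
def IsValue : Tm → Prop
  | .str _ => True
  | .lam _ _ _ _ => True
  | _ => False

/-- Substitution of a (closed) term `v` for the variable `x`. -/
def tsubst (v : Tm) (x : ℕ) : Tm → Tm
  | .var y => if y = x then v else .var y
  | .str m => .str m
  | .lam y a A t => if y = x then .lam y a A t else .lam y a A (tsubst v x t)
  | .app t s => .app (tsubst v x t) (tsubst v x s)
  | .zero t => .zero (tsubst v x t)
  | .one t => .one (tsubst v x t)
  | .tail t => .tail (tsubst v x t)
  | .tcase A t t0 t1 te => .tcase A (tsubst v x t) (tsubst v x t0) (tsubst v x t1) (tsubst v x te)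
  | .trec A t t0 t1 te => .trec A (tsubst v x t) (tsubst v x t0) (tsubst v x t1) (tsubst v x te)
  | .rand => .rand

/-- Typing contexts: assignments of an aspect and a type to variables. -/
abbrev TyCtx := List (ℕ × Aspect × Ty)

/-- The typing judgment `Γ ⊢ t : A` of RSLR. -/
inductive HasType : TyCtx → Tm → Ty → Prop
  | var {Γ : TyCtx} {x : ℕ} {a : Aspect} {A : Ty} :
      (x, a, A) ∈ Γ → HasType Γ (Tm.var x) A
  | str {Γ : TyCtx} {m : BStr} : HasType Γ (Tm.str m) Ty.str
  | rand {Γ : TyCtx} : HasType Γ Tm.rand Ty.str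
  | zero {Γ : TyCtx} {t : Tm} : HasType Γ t Ty.str → HasType Γ (Tm.zero t) Ty.str
  | one {Γ : TyCtx} {t : Tm} : HasType Γ t Ty.str → HasType Γ (Tm.one t) Ty.str
  | tail {Γ : TyCtx} {t : Tm} : HasType Γ t Ty.str → HasType Γ (Tm.tail t) Ty.str
  | lam {Γ : TyCtx} {x : ℕ} {a : Aspect} {A B : Ty} {t : Tm} :
      HasType ((x, a, A) :: Γ) t B → HasType Γ (Tm.lam x a A t) (Ty.arrow a A B)
  | app {Γ : TyCtx} {a : Aspect} {A B : Ty} {t s : Tm} :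
      HasType Γ t (Ty.arrow a A B) → HasType Γ s A → HasType Γ (Tm.app t s) B
  | tcase {Γ : TyCtx} {A : Ty} {t t0 t1 te : Tm} :
      HasType Γ t Ty.str → HasType Γ t0 A → HasType Γ t1 A → HasType Γ te A →
      HasType Γ (Tm.tcase A t t0 t1 te) A
  | trec {Γ : TyCtx} {A : Ty} {t t0 t1 te : Tm} :
      HasType Γ t Ty.str →
      HasType Γ t0 (Ty.arrow .box Ty.str (Ty.arrow .bbox A A)) →
      HasType Γ t1 (Ty.arrow .box Ty.str (Ty.arrow .bbox A A)) →
      HasType Γ te A → A.boxFree → HasType Γ (Tm.trec A t t0 t1 te) A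
  | sub {Γ : TyCtx} {t : Tm} {A B : Ty} : HasType Γ t A → SubTy A B → HasType Γ t B

/-! ### Big-step (distribution) semantics -/

/-- The distribution `{0^{1/2}, 1^{1/2}}` produced by `rand`. -/
noncomputable def randPMF : PMF Tm := (PMF.uniformOfFintype Bool).map (fun b => Tm.str [b])

/-- Prepend a bit to a string value. -/
def consBit (b : Bool) : Tm → Tm
  | .str m => .str (b :: m)
  | t => t

/-- Tail of a string value (`tail ε = ε`). -/
def tailFn : Tm → Tm
  | .str (_ :: m) => .str m
  | t => t

/-- β-application of a value to an abstraction. -/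
def applyLam (v : Tm) : Tm → Tm
  | .lam x _ _ t => tsubst v x t
  | t => t

/-- Selection of the branch distribution in a `case`, by the evaluated scrutinee. -/
noncomputable def caseRes (D0 D1 De : PMF Tm) : Tm → PMF Tm
  | .str [] => De
  | .str (false :: _) => D0
  | .str (true :: _) => D1
  | v => PMF.pure v

/-- Selection of the continuation distribution in a `rec`, by the evaluated scrutinee. -/
noncomputable def recRes (De : PMF Tm) (F : Bool → BStr → PMF Tm) : Tm → PMF Tm
  | .str [] => De
  | .str (b :: n) => F b n
  | v => PMF.pure v

/-- The big-step semantics `t ⇓ D` of RSLR, relating closed terms to value distributions. -/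
inductive BigStep : Tm → PMF Tm → Prop
  | val {v : Tm} : IsValue v → BigStep v (PMF.pure v)
  | rand : BigStep Tm.rand randPMF
  | zero {t : Tm} {D : PMF Tm} : BigStep t D → BigStep (Tm.zero t) (D.map (consBit false))
  | one {t : Tm} {D : PMF Tm} : BigStep t D → BigStep (Tm.one t) (D.map (consBit true))
  | tail {t : Tm} {D : PMF Tm} : BigStep t D → BigStep (Tm.tail t) (D.map tailFn)
  | app {t s : Tm} {D E : PMF Tm} {F : Tm → Tm → PMF Tm} :
      BigStep t D → BigStep s E →
      (∀ f ∈ D.support, ∀ v ∈ E.support, BigStep (applyLam v f) (F f v)) →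
      BigStep (Tm.app t s) (D.bind fun f => E.bind fun v => F f v)
  | tcase {A : Ty} {t t0 t1 te : Tm} {D D0 D1 De : PMF Tm} :
      BigStep t D → BigStep t0 D0 → BigStep t1 D1 → BigStep te De →
      BigStep (Tm.tcase A t t0 t1 te) (D.bind (caseRes D0 D1 De))
  | trec {A : Ty} {t t0 t1 te : Tm} {D De : PMF Tm} {F : Bool → BStr → PMF Tm} :
      BigStep t D → BigStep te De →
      (∀ (b : Bool) (n : BStr), Tm.str (b :: n) ∈ D.support →
        BigStep (Tm.app (Tm.app (if b then t1 else t0) (Tm.str (b :: n)))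
          (Tm.trec A (Tm.str n) t0 t1 te)) (F b n)) →
      BigStep (Tm.trec A t t0 t1 te) (D.bind (recRes De F))

/-- `⟦t⟧`: the distribution of `t` (chosen via the big-step semantics). -/
noncomputable def sem (t : Tm) : PMF Tm :=
  if h : ∃ D : PMF Tm, BigStep t D then h.choose else PMF.pure t

/-! ### Small-step semantics on terms and term distributions -/

/-- Dispatch of a `case` on the leading bit of the scrutinee. -/
def caseDispatch (t0 t1 te : Tm) : BStr → Tm
  | [] => te
  | false :: _ => t0
  | true :: _ => t1

/-- Unfolding of a `rec` on the leading bit of the scrutinee. -/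
def recDispatch (A : Ty) (t0 t1 te : Tm) : BStr → Tm
  | [] => te
  | b :: n => Tm.app (Tm.app (if b then t1 else t0) (Tm.str (b :: n))) (Tm.trec A (Tm.str n) t0 t1 te)

/-- One-step (probabilistic) reduction `t → {tᵢ^{pᵢ}}` on terms. -/
inductive Step : Tm → PMF Tm → Prop
  | beta {x : ℕ} {a : Aspect} {A : Ty} {t v : Tm} :
      IsValue v → Step (Tm.app (Tm.lam x a A t) v) (PMF.pure (tsubst v x t))
  | rand : Step Tm.rand randPMF
  | zeroV {m : BStr} : Step (Tm.zero (Tm.str m)) (PMF.pure (Tm.str (false :: m)))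
  | oneV {m : BStr} : Step (Tm.one (Tm.str m)) (PMF.pure (Tm.str (true :: m)))
  | tailV {m : BStr} : Step (Tm.tail (Tm.str m)) (PMF.pure (tailFn (Tm.str m)))
  | caseV {A : Ty} {m : BStr} {t0 t1 te : Tm} :
      Step (Tm.tcase A (Tm.str m) t0 t1 te) (PMF.pure (caseDispatch t0 t1 te m))
  | trecV {A : Ty} {m : BStr} {t0 t1 te : Tm} :
      Step (Tm.trec A (Tm.str m) t0 t1 te) (PMF.pure (recDispatch A t0 t1 te m))
  | appL {t s : Tm} {D : PMF Tm} : Step t D → Step (Tm.app t s) (D.map fun t' => Tm.app t' s)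
  | appR {v s : Tm} {D : PMF Tm} :
      IsValue v → Step s D → Step (Tm.app v s) (D.map fun s' => Tm.app v s')
  | zeroC {t : Tm} {D : PMF Tm} : Step t D → Step (Tm.zero t) (D.map Tm.zero)
  | oneC {t : Tm} {D : PMF Tm} : Step t D → Step (Tm.one t) (D.map Tm.one)
  | tailC {t : Tm} {D : PMF Tm} : Step t D → Step (Tm.tail t) (D.map Tm.tail)
  | caseC {A : Ty} {t t0 t1 te : Tm} {D : PMF Tm} :
      Step t D → Step (Tm.tcase A t t0 t1 te) (D.map fun t' => Tm.tcase A t' t0 t1 te)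
  | trecC {A : Ty} {t t0 t1 te : Tm} {D : PMF Tm} :
      Step t D → Step (Tm.trec A t t0 t1 te) (D.map fun t' => Tm.trec A t' t0 t1 te)

/-- Internal reduction `T ⇛ T'` of term distributions: one term of the support
makes one reduction step. -/
def IntStep (T T' : PMF Tm) : Prop :=
  ∃ t ∈ T.support, ∃ D : PMF Tm, Step t D ∧
    T' = T.bind fun s => if s = t then D else PMF.pure s

/-- A term distribution all of whose support consists of abstractions. -/
def IsLamD (T : PMF Tm) : Prop := ∀ t ∈ T.support, ∃ x a A b, t = Tm.lam x a A b

/-- A term distribution all of whose support consists of string constants. -/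
def IsStrD (T : PMF Tm) : Prop := ∀ t ∈ T.support, ∃ m : BStr, t = Tm.str m

/-! ### Linear contexts -/

/-- Linear contexts: terms with (at most) one hole, lying outside any recursion
(the hole may appear as the scrutinee of a `rec`, but not inside its branches). -/
inductive Cx : Type
  | hole : Cx
  | term : Tm → Cx
  | lam : ℕ → Aspect → Ty → Cx → Cx
  | appL : Cx → Tm → Cx
  | appR : Tm → Cx → Cx
  | zero : Cx → Cx
  | one : Cx → Cx
  | tail : Cx → Cx
  | caseS : Ty → Cx → Tm → Tm → Tm → Cx
  | case0 : Ty → Tm → Cx → Tm → Tm → Cx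
  | case1 : Ty → Tm → Tm → Cx → Tm → Cx
  | caseE : Ty → Tm → Tm → Tm → Cx → Cx
  | recS : Ty → Cx → Tm → Tm → Tm → Cx

/-- `C[t]`: filling the hole of a context with a term. -/
def Cx.fill : Cx → Tm → Tm
  | .hole, u => u
  | .term t, _ => t
  | .lam x a A C, u => Tm.lam x a A (C.fill u)
  | .appL C t, u => Tm.app (C.fill u) t
  | .appR t C, u => Tm.app t (C.fill u)
  | .zero C, u => Tm.zero (C.fill u)
  | .one C, u => Tm.one (C.fill u)
  | .tail C, u => Tm.tail (C.fill u)
  | .caseS A C t0 t1 te, u => Tm.tcase A (C.fill u) t0 t1 te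
  | .case0 A t C t1 te, u => Tm.tcase A t (C.fill u) t1 te
  | .case1 A t t0 C te, u => Tm.tcase A t t0 (C.fill u) te
  | .caseE A t t0 t1 C, u => Tm.tcase A t t0 t1 (C.fill u)
  | .recS A C t0 t1 te, u => Tm.trec A (C.fill u) t0 t1 te

/-- Context typing `⊢ C[⊢A] : B`: for every closed `t : A`, `⊢ C[t] : B`. -/
def CxTy (C : Cx) (A B : Ty) : Prop :=
  ∀ t : Tm, HasType [] t A → HasType [] (C.fill t) B

/-- `C[T]`: filling a context with every term of a term distribution. -/
noncomputable def Cx.fillD (C : Cx) (T : PMF Tm) : PMF Tm := T.map C.fill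

/-- Whether a context actually contains the hole. -/
def Cx.hasHole : Cx → Bool
  | .hole => true
  | .term _ => false
  | .lam _ _ _ C => C.hasHole
  | .appL C _ => C.hasHole
  | .appR _ C => C.hasHole
  | .zero C => C.hasHole
  | .one C => C.hasHole
  | .tail C => C.hasHole
  | .caseS _ C _ _ _ => C.hasHole
  | .case0 _ _ C _ _ => C.hasHole
  | .case1 _ _ _ C _ => C.hasHole
  | .caseE _ _ _ _ C => C.hasHole
  | .recS _ C _ _ _ => C.hasHole

/-- Substitution of a value for a variable inside a context. -/
def Cx.substV (v : Tm) (x : ℕ) : Cx → Cx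
  | .hole => .hole
  | .term t => .term (tsubst v x t)
  | .lam y a A C => if y = x then .lam y a A C else .lam y a A (C.substV v x)
  | .appL C t => .appL (C.substV v x) (tsubst v x t)
  | .appR t C => .appR (tsubst v x t) (C.substV v x)
  | .zero C => .zero (C.substV v x)
  | .one C => .one (C.substV v x)
  | .tail C => .tail (C.substV v x)
  | .caseS A C t0 t1 te =>
      .caseS A (C.substV v x) (tsubst v x t0) (tsubst v x t1) (tsubst v x te)
  | .case0 A t C t1 te =>
      .case0 A (tsubst v x t) (C.substV v x) (tsubst v x t1) (tsubst v x te)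
  | .case1 A t t0 C te =>
      .case1 A (tsubst v x t) (tsubst v x t0) (C.substV v x) (tsubst v x te)
  | .caseE A t t0 t1 C =>
      .caseE A (tsubst v x t) (tsubst v x t0) (tsubst v x t1) (C.substV v x)
  | .recS A C t0 t1 te =>
      .recS A (C.substV v x) (tsubst v x t0) (tsubst v x t1) (tsubst v x te)

/-- Occurrence check for a variable in a term. -/
def occurs (x : ℕ) : Tm → Bool
  | .var y => y = x
  | .str _ => false
  | .lam y _ _ t => if y = x then false else occurs x t
  | .app t s => occurs x t || occurs x s
  | .zero t => occurs x t
  | .one t => occurs x t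
  | .tail t => occurs x t
  | .tcase _ t t0 t1 te => occurs x t || occurs x t0 || occurs x t1 || occurs x te
  | .trec _ t t0 t1 te => occurs x t || occurs x t0 || occurs x t1 || occurs x te
  | .rand => false

/-- `t{C/x}`: substitution of a context for a (linearly occurring) variable in a term,
yielding a context. -/
def substCx (C : Cx) (x : ℕ) : Tm → Cx
  | .var y => if y = x then C else .term (.var y)
  | .str m => .term (.str m)
  | .lam y a A t =>
      if y = x then .term (.lam y a A t)
      else if occurs x t then .lam y a A (substCx C x t) else .term (.lam y a A t)
  | .app t s =>
      if occurs x t then .appL (substCx C x t) s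
      else if occurs x s then .appR t (substCx C x s)
      else .term (.app t s)
  | .zero t => if occurs x t then .zero (substCx C x t) else .term (.zero t)
  | .one t => if occurs x t then .one (substCx C x t) else .term (.one t)
  | .tail t => if occurs x t then .tail (substCx C x t) else .term (.tail t)
  | .tcase A t t0 t1 te =>
      if occurs x t then .caseS A (substCx C x t) t0 t1 te
      else if occurs x t0 then .case0 A t (substCx C x t0) t1 te
      else if occurs x t1 then .case1 A t t0 (substCx C x t1) te
      else if occurs x te then .caseE A t t0 t1 (substCx C x te)
      else .term (.tcase A t t0 t1 te)
  | .trec A t t0 t1 te =>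
      if occurs x t then .recS A (substCx C x t) t0 t1 te
      else .term (.trec A t t0 t1 te)
  | .rand => .term .rand

/-- The string observed from a normal context pair: the value produced by a context
whose result is of base type, given the term filling the hole. -/
def obs : Cx → Tm → Option BStr
  | .hole, .str m => some m
  | .term (.str m), _ => some m
  | .zero C, t => (obs C t).map (fun m => false :: m)
  | .one C, t => (obs C t).map (fun m => true :: m)
  | .tail C, t => (obs C t).map List.tail
  | _, _ => none

/-! ### Context pairs and their reduction -/

/-- A context pair `(C, T)` is a value when every filling produces a value. -/
def PairVal (C : Cx) (T : PMF Tm) : Prop := ∀ t ∈ T.support, IsValue (C.fill t)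

/-- A context pair producing a string observation on all of its support. -/
def StrObs (C : Cx) (T : PMF Tm) : Prop := ∀ t ∈ T.support, ∃ m : BStr, obs C t = some m

/-- The `pass`-action on context pairs: either the hole (filled with a distribution of
abstractions) or a λ-context receives the value. -/
inductive PairPass : Cx × PMF Tm → Tm → Cx × PMF Tm → Prop
  | hole {T : PMF Tm} {v : Tm} :
      IsLamD T → PairPass (Cx.hole, T) v (Cx.hole, T.map (applyLam v))
  | lam {x : ℕ} {a : Aspect} {A : Ty} {C : Cx} {T : PMF Tm} {v : Tm} :
      PairPass (Cx.lam x a A C, T) v (C.substV v x, T)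

/-- Dispatch of a `case` whose first branch holds the hole. -/
def case0Disp (C0 : Cx) (t1 te : Tm) : BStr → Cx
  | [] => .term te
  | false :: _ => C0
  | true :: _ => .term t1

/-- Dispatch of a `case` whose second branch holds the hole. -/
def case1Disp (t0 : Tm) (C1 : Cx) (te : Tm) : BStr → Cx
  | [] => .term te
  | false :: _ => .term t0
  | true :: _ => C1

/-- Dispatch of a `case` whose third branch holds the hole. -/
def caseEDisp (t0 t1 : Tm) (Ce : Cx) : BStr → Cx
  | [] => Ce
  | false :: _ => .term t0
  | true :: _ => .term t1

/-- One-step internal reduction of context pairs: either the context reduces, or the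
term distribution in the hole reduces, or the context consumes the observation of
the hole (in a `case` or `rec` scrutinee position). -/
inductive PairStep : Cx × PMF Tm → PMF (Cx × PMF Tm) → Prop
  | term {t : Tm} {D : PMF Tm} {T : PMF Tm} :
      Step t D → PairStep (Cx.term t, T) (D.map fun t' => (Cx.term t', T))
  | holeInt {T T' : PMF Tm} :
      IntStep T T' → PairStep (Cx.hole, T) (PMF.pure (Cx.hole, T'))
  | appPass {C : Cx} {T : PMF Tm} {v : Tm} {c' : Cx × PMF Tm} :
      IsValue v → PairPass (C, T) v c' → PairStep (Cx.appL C v, T) (PMF.pure c')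
  | appLC {C : Cx} {t : Tm} {T : PMF Tm} {P : PMF (Cx × PMF Tm)} :
      PairStep (C, T) P → PairStep (Cx.appL C t, T) (P.map fun c => (Cx.appL c.1 t, c.2))
  | appLArg {C : Cx} {T : PMF Tm} {t : Tm} {D : PMF Tm} :
      PairVal C T → Step t D →
      PairStep (Cx.appL C t, T) (D.map fun t' => (Cx.appL C t', T))
  | appRC {v : Tm} {C : Cx} {T : PMF Tm} {P : PMF (Cx × PMF Tm)} :
      IsValue v → PairStep (C, T) P →
      PairStep (Cx.appR v C, T) (P.map fun c => (Cx.appR v c.1, c.2))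
  | appRFun {t : Tm} {C : Cx} {T : PMF Tm} {D : PMF Tm} :
      Step t D → PairStep (Cx.appR t C, T) (D.map fun t' => (Cx.appR t' C, T))
  | betaArg {x : ℕ} {a : Aspect} {A : Ty} {t : Tm} {C : Cx} {T : PMF Tm} :
      PairVal C T →
      PairStep (Cx.appR (Tm.lam x a A t) C, T) (PMF.pure (substCx C x t, T))
  | zeroC {C : Cx} {T : PMF Tm} {P : PMF (Cx × PMF Tm)} :
      PairStep (C, T) P → PairStep (Cx.zero C, T) (P.map fun c => (Cx.zero c.1, c.2))
  | oneC {C : Cx} {T : PMF Tm} {P : PMF (Cx × PMF Tm)} :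
      PairStep (C, T) P → PairStep (Cx.one C, T) (P.map fun c => (Cx.one c.1, c.2))
  | tailC {C : Cx} {T : PMF Tm} {P : PMF (Cx × PMF Tm)} :
      PairStep (C, T) P → PairStep (Cx.tail C, T) (P.map fun c => (Cx.tail c.1, c.2))
  | zeroV {m : BStr} {T : PMF Tm} :
      PairStep (Cx.zero (Cx.term (Tm.str m)), T)
        (PMF.pure (Cx.term (Tm.str (false :: m)), T))
  | oneV {m : BStr} {T : PMF Tm} :
      PairStep (Cx.one (Cx.term (Tm.str m)), T)
        (PMF.pure (Cx.term (Tm.str (true :: m)), T))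
  | tailV {m : BStr} {T : PMF Tm} :
      PairStep (Cx.tail (Cx.term (Tm.str m)), T)
        (PMF.pure (Cx.term (tailFn (Tm.str m)), T))
  | caseSC {A : Ty} {C : Cx} {t0 t1 te : Tm} {T : PMF Tm} {P : PMF (Cx × PMF Tm)} :
      PairStep (C, T) P →
      PairStep (Cx.caseS A C t0 t1 te, T) (P.map fun c => (Cx.caseS A c.1 t0 t1 te, c.2))
  | caseSDisp {A : Ty} {C : Cx} {T : PMF Tm} {t0 t1 te : Tm} :
      StrObs C T →
      PairStep (Cx.caseS A C t0 t1 te, T)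
        (T.map fun t => (Cx.term (caseDispatch t0 t1 te ((obs C t).getD [])), T))
  | case0Scrut {A : Ty} {t : Tm} {C0 : Cx} {t1 te : Tm} {D : PMF Tm} {T : PMF Tm} :
      Step t D →
      PairStep (Cx.case0 A t C0 t1 te, T) (D.map fun t' => (Cx.case0 A t' C0 t1 te, T))
  | case0V {A : Ty} {m : BStr} {C0 : Cx} {t1 te : Tm} {T : PMF Tm} :
      PairStep (Cx.case0 A (Tm.str m) C0 t1 te, T) (PMF.pure (case0Disp C0 t1 te m, T))
  | case1Scrut {A : Ty} {t t0 : Tm} {C1 : Cx} {te : Tm} {D : PMF Tm} {T : PMF Tm} :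
      Step t D →
      PairStep (Cx.case1 A t t0 C1 te, T) (D.map fun t' => (Cx.case1 A t' t0 C1 te, T))
  | case1V {A : Ty} {m : BStr} {t0 : Tm} {C1 : Cx} {te : Tm} {T : PMF Tm} :
      PairStep (Cx.case1 A (Tm.str m) t0 C1 te, T) (PMF.pure (case1Disp t0 C1 te m, T))
  | caseEScrut {A : Ty} {t t0 t1 : Tm} {Ce : Cx} {D : PMF Tm} {T : PMF Tm} :
      Step t D →
      PairStep (Cx.caseE A t t0 t1 Ce, T) (D.map fun t' => (Cx.caseE A t' t0 t1 Ce, T))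
  | caseEV {A : Ty} {m : BStr} {t0 t1 : Tm} {Ce : Cx} {T : PMF Tm} :
      PairStep (Cx.caseE A (Tm.str m) t0 t1 Ce, T) (PMF.pure (caseEDisp t0 t1 Ce m, T))
  | recSC {A : Ty} {C : Cx} {t0 t1 te : Tm} {T : PMF Tm} {P : PMF (Cx × PMF Tm)} :
      PairStep (C, T) P →
      PairStep (Cx.recS A C t0 t1 te, T) (P.map fun c => (Cx.recS A c.1 t0 t1 te, c.2))
  | recSDisp {A : Ty} {C : Cx} {T : PMF Tm} {t0 t1 te : Tm} :
      StrObs C T →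
      PairStep (Cx.recS A C t0 t1 te, T)
        (T.map fun t => (Cx.term (recDispatch A t0 t1 te ((obs C t).getD [])), T))

/-- Internal reduction `P ⇛ P'` of (context) pair distributions. -/
def PIntStep (P P' : PMF (Cx × PMF Tm)) : Prop :=
  ∃ c ∈ P.support, ∃ Q : PMF (Cx × PMF Tm), PairStep c Q ∧
    P' = P.bind fun d => if d = c then Q else PMF.pure d

/-- A pair distribution is normal when every filling of every pair in its support
is a value. -/
def PNormal (P : PMF (Cx × PMF Tm)) : Prop :=
  ∀ c ∈ P.support, ∀ t ∈ c.2.support, IsValue (Cx.fill c.1 t)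

/-! ### Traces (with finite-set observations) and the trace metric -/

/-- Actions: passing a value, or viewing a finite set of strings. -/
inductive Act : Type
  | pass : Tm → Act
  | view : Finset BStr → Act

/-- Traces: finite sequences of actions. -/
abbrev Trace := List Act

/-- Labeled small-step reduction of term distributions along the `pass`-actions of a
trace, interleaved with internal reduction. -/
inductive TraceStep : PMF Tm → Trace → PMF Tm → Prop
  | refl (T : PMF Tm) : TraceStep T [] T
  | internal {T : PMF Tm} {S : Trace} {T' T'' : PMF Tm} :
      TraceStep T S T' → IntStep T' T'' → TraceStep T S T''
  | pass {T : PMF Tm} {S : Trace} {T' : PMF Tm} {v : Tm} :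
      TraceStep T S T' → IsLamD T' →
      TraceStep T (S ++ [Act.pass v]) (T'.map (applyLam v))

/-- `T ↦^S p`: the probability that a term distribution accepts a trace ending with a
`view`-action on a finite set of strings. -/
inductive TraceAcc : PMF Tm → Trace → ℝ → Prop
  | view {T : PMF Tm} {S : Trace} {T' : PMF Tm} {M : Finset BStr} :
      TraceStep T S T' → IsStrD T' →
      TraceAcc T (S ++ [Act.view M]) ((∑ m ∈ M, T' (Tm.str m)).toReal)

/-- `Pr(T, S)`, the probability that `T` accepts the trace `S`. -/
noncomputable def prT (T : PMF Tm) (S : Trace) : ℝ :=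
  if h : ∃ p : ℝ, TraceAcc T S p then h.choose else 0

/-- The trace distance `δ^T(T, S) = sup_S |Pr(T, S) − Pr(S, S)|`. -/
noncomputable def tdist (T S : PMF Tm) : ℝ := ⨆ tr : Trace, |prT T tr - prT S tr|

/-- The probability that a (normal) context pair exhibits a string in `M`. -/
noncomputable def pairView (C : Cx) (T : PMF Tm) (M : Finset BStr) : ℝ :=
  (∑' t : Tm, if ∃ m ∈ M, obs C t = some m then T t else 0).toReal

/-- Labeled small-step reduction of pair distributions along the `pass`-actions of a
trace, interleaved with internal reduction. -/
inductive PTraceStep : PMF (Cx × PMF Tm) → Trace → PMF (Cx × PMF Tm) → Prop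
  | refl (P : PMF (Cx × PMF Tm)) : PTraceStep P [] P
  | internal {P : PMF (Cx × PMF Tm)} {S : Trace} {P' P'' : PMF (Cx × PMF Tm)} :
      PTraceStep P S P' → PIntStep P' P'' → PTraceStep P S P''
  | pass {P : PMF (Cx × PMF Tm)} {S : Trace} {P' : PMF (Cx × PMF Tm)} {v : Tm}
      (f : Cx × PMF Tm → Cx × PMF Tm) :
      PTraceStep P S P' → (∀ c ∈ P'.support, PairPass c v (f c)) →
      PTraceStep P (S ++ [Act.pass v]) (P'.map f)

/-- `P ↦^S p`: trace acceptance probability for pair distributions. -/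
inductive PTraceAcc : PMF (Cx × PMF Tm) → Trace → ℝ → Prop
  | view {P : PMF (Cx × PMF Tm)} {S : Trace} {P' : PMF (Cx × PMF Tm)} {M : Finset BStr} :
      PTraceStep P S P' →
      PTraceAcc P (S ++ [Act.view M])
        (∑' c : Cx × PMF Tm, (P' c).toReal * pairView c.1 c.2 M)

/-- `P ▽_d Q`: the two pair distributions are given by families with the same
contexts, term distributions at trace distance at most `d`, equal weights on
contexts containing the hole, and weights within `rᵢ·d` on hole-free contexts. -/
def DRel (d : ℝ) (P Q : PMF (Cx × PMF Tm)) : Prop :=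
  ∃ (I : Type) (C : I → Cx) (T S : I → PMF Tm) (p q r : I → ℝ≥0∞),
    (∑' i, r i) = 1 ∧
    (∀ i, tdist (T i) (S i) ≤ d) ∧
    (∀ i, (C i).hasHole = true → p i = r i ∧ q i = r i) ∧
    (∀ i, (C i).hasHole = false → |(p i).toReal - (q i).toReal| ≤ (r i).toReal * d) ∧
    (∀ c, P c = ∑' i, if c = (C i, T i) then p i else 0) ∧
    (∀ c, Q c = ∑' i, if c = (C i, S i) then q i else 0)

/-- The context distance `δ^C(t, s)` between closed terms of type `A`. -/
noncomputable def cdist (A : Ty) (t s : Tm) : ℝ :=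
  ⨆ C : {C : Cx // CxTy C A Ty.str},
    |(sem (Cx.fill C.1 t) (Tm.str [])).toReal - (sem (Cx.fill C.1 s) (Tm.str [])).toReal|

/-! ### Determinism of one-step reduction -/

theorem not_step_of_isValue {t : Tm} {D : PMF Tm} (hv : IsValue t) : ¬ Step t D := by
  intro h
  cases h <;> exact hv

theorem Step.unique {t : Tm} {D E : PMF Tm} (hD : Step t D) (hE : Step t E) : D = E := by
  induction hD generalizing E with
  | beta hv =>
    cases hE with
    | beta => rfl
    | appL h => exact absurd h (not_step_of_isValue trivial)
    | appR _ h => exact absurd h (not_step_of_isValue hv)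
  | rand => cases hE; rfl
  | zeroV | oneV | tailV | caseV | trecV =>
    cases hE <;> first
      | rfl
      | exact absurd ‹Step (Tm.str _) _› (not_step_of_isValue trivial)
  | appL h ih =>
    cases hE with
    | beta => exact absurd h (not_step_of_isValue trivial)
    | appL h' => rw [ih h']
    | appR hv => exact absurd h (not_step_of_isValue hv)
  | appR hv h ih =>
    cases hE with
    | beta hv' => exact absurd h (not_step_of_isValue hv')
    | appL h' => exact absurd h' (not_step_of_isValue hv)
    | appR _ h' => rw [ih h']
  | zeroC h ih | oneC h ih | tailC h ih | caseC h ih | trecC h ih =>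
    cases hE <;> first
      | exact absurd h (not_step_of_isValue trivial)
      | rw [ih ‹_›]

/-! ### Reduction schedules -/

theorem PMF.bind_congr_support {α β : Type*} {p : PMF α} {f g : α → PMF β}
    (h : ∀ a ∈ p.support, f a = g a) : p.bind f = p.bind g := by
  ext b
  simp only [PMF.bind_apply]
  refine tsum_congr fun a => ?_
  by_cases ha : p a = 0
  · simp [ha]
  · rw [h a ((PMF.mem_support_iff p a).2 ha)]

/-- A term is reducible when it admits a reduction step. -/
def Reducible (t : Tm) : Prop := ∃ D : PMF Tm, Step t D

/-- The one-step reduct of a term, or the term itself when it is irreducible. -/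
noncomputable def reduct (t : Tm) : PMF Tm :=
  if h : Reducible t then h.choose else PMF.pure t

theorem reduct_eq_of_step {t : Tm} {D : PMF Tm} (h : Step t D) : reduct t = D := by
  have hr : Reducible t := ⟨D, h⟩
  rw [reduct, dif_pos hr]
  exact hr.choose_spec.unique h

theorem step_reduct {t : Tm} (h : Reducible t) : Step t (reduct t) := by
  rw [reduct, dif_pos h]
  exact h.choose_spec

theorem reduct_of_not_reducible {t : Tm} (h : ¬ Reducible t) : reduct t = PMF.pure t :=
  dif_neg h

/-- The result of reducing, one after the other, the terms of a schedule `l` wherever they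
occur, starting from the term `s`. -/
noncomputable def run : List Tm → Tm → PMF Tm
  | [], s => PMF.pure s
  | x :: l, s => if s = x then (reduct x).bind (run l) else run l s

/-- A term distribution all of whose support consists of irreducible terms. -/
def IsNormalD (T : PMF Tm) : Prop := ∀ t ∈ T.support, ¬ Reducible t

theorem IsLamD.isNormalD {T : PMF Tm} (h : IsLamD T) : IsNormalD T := by
  rintro t ht ⟨D, hD⟩
  obtain ⟨x, a, A, b, rfl⟩ := h t ht
  exact not_step_of_isValue (by trivial) hD

theorem IsStrD.isNormalD {T : PMF Tm} (h : IsStrD T) : IsNormalD T := by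
  rintro t ht ⟨D, hD⟩
  obtain ⟨m, rfl⟩ := h t ht
  exact not_step_of_isValue (by trivial) hD

theorem IsNormalD.of_bind {α : Type*} {p : PMF α} {f : α → PMF Tm} (h : IsNormalD (p.bind f))
    {a : α} (ha : a ∈ p.support) : IsNormalD (f a) := fun t ht =>
  h t ((PMF.mem_support_bind_iff p f t).2 ⟨a, ha, ht⟩)

/-- Reducing a term first does not change the outcome of a schedule that normalizes it. -/
theorem reduct_bind_run {l : List Tm} {s : Tm} (h : IsNormalD (run l s)) :
    (reduct s).bind (run l) = run l s := by
  induction l generalizing s with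
  | nil =>
    have hs : ¬ Reducible s := h s (by simp [run])
    rw [reduct_of_not_reducible hs, PMF.pure_bind]
  | cons x l ih =>
    have key : ∀ u, IsNormalD (run l u) → run (x :: l) u = run l u := by
      intro u hu
      by_cases hux : u = x
      · subst hux
        simpa [run] using ih hu
      · simp [run, hux]
    have tail_eq : run (x :: l) s = (reduct s).bind (run l) := by
      by_cases hsx : s = x
      · simp [run, hsx]
      · have hs : run (x :: l) s = run l s := by simp [run, hsx]
        rw [hs] at h ⊢
        exact (ih h).symm
    rw [tail_eq] at h ⊢
    exact PMF.bind_congr_support fun u hu => key u (h.of_bind hu)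

theorem run_cons_of_isNormalD {l : List Tm} {x s : Tm} (h : IsNormalD (run l s)) :
    run (x :: l) s = run l s := by
  by_cases hsx : s = x
  · subst hsx
    simpa [run] using reduct_bind_run h
  · simp [run, hsx]

/-! ### Confluence of internal reduction to normal distributions -/

/-- Iterated internal reduction. -/
abbrev IntSteps : PMF Tm → PMF Tm → Prop := Relation.ReflTransGen IntStep

theorem bind_ite_bind_run (T : PMF Tm) (x : Tm) (l : List Tm) :
    (T.bind fun s => if s = x then reduct x else PMF.pure s).bind (run l) =
      T.bind (run (x :: l)) := by
  rw [PMF.bind_bind]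
  congr 1
  funext s
  by_cases hsx : s = x <;> simp [run, hsx]

theorem IntStep.exists_eq {T T' : PMF Tm} (h : IntStep T T') :
    ∃ x, T' = T.bind fun s => if s = x then reduct x else PMF.pure s := by
  obtain ⟨x, -, D, hD, rfl⟩ := h
  exact ⟨x, by rw [reduct_eq_of_step hD]⟩

theorem IntSteps.exists_run {T V : PMF Tm} (h : IntSteps T V) : ∃ l, V = T.bind (run l) := by
  induction h using Relation.ReflTransGen.head_induction_on with
  | refl => exact ⟨[], (PMF.bind_pure V).symm⟩
  | head hstep _ ih =>
    obtain ⟨l, hl⟩ := ih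
    obtain ⟨x, rfl⟩ := hstep.exists_eq
    exact ⟨x :: l, hl.trans (bind_ite_bind_run _ x l)⟩

theorem intSteps_bind_run (T : PMF Tm) (l : List Tm) : IntSteps T (T.bind (run l)) := by
  induction l generalizing T with
  | nil =>
    have : T.bind (run []) = T := PMF.bind_pure T
    rw [this]
  | cons x l ih =>
    rw [← bind_ite_bind_run]
    refine Relation.ReflTransGen.trans ?_ (ih _)
    by_cases hx : x ∈ T.support ∧ Reducible x
    · exact Relation.ReflTransGen.single ⟨x, hx.1, reduct x, step_reduct hx.2, rfl⟩
    · have : (T.bind fun s => if s = x then reduct x else PMF.pure s) = T := by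
        refine (PMF.bind_congr_support fun s hs => ?_).trans (PMF.bind_pure T)
        by_cases hsx : s = x
        · subst hsx
          rw [if_pos rfl, reduct_of_not_reducible fun hr => hx ⟨hs, hr⟩]
        · exact if_neg hsx
      rw [this]

theorem IntStep.intSteps_of_isNormalD {T T' V : PMF Tm} (h : IntStep T T')
    (hV : IntSteps T V) (hn : IsNormalD V) : IntSteps T' V := by
  obtain ⟨l, rfl⟩ := hV.exists_run
  obtain ⟨x, rfl⟩ := h.exists_eq
  have key : T.bind (run (x :: l)) = T.bind (run l) :=
    PMF.bind_congr_support fun s hs => run_cons_of_isNormalD (hn.of_bind hs)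
  rw [← key, ← bind_ite_bind_run]
  exact intSteps_bind_run _ l

theorem IntSteps.intSteps_of_isNormalD {T T' V : PMF Tm} (h : IntSteps T T')
    (hV : IntSteps T V) (hn : IsNormalD V) : IntSteps T' V := by
  induction h with
  | refl => exact hV
  | tail _ hstep ih => exact hstep.intSteps_of_isNormalD ih hn

theorem IsNormalD.eq_of_intSteps {T V : PMF Tm} (hn : IsNormalD T) (h : IntSteps T V) :
    T = V := by
  rcases Relation.ReflTransGen.cases_head h with rfl | ⟨U, ⟨t, ht, D, hD, -⟩, -⟩
  · rfl
  · exact absurd ⟨D, hD⟩ (hn t ht)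

theorem IntSteps.unique {T V W : PMF Tm} (hV : IntSteps T V) (hW : IntSteps T W)
    (hVn : IsNormalD V) (hWn : IsNormalD W) : V = W :=
  hVn.eq_of_intSteps (hV.intSteps_of_isNormalD hW hWn)

/-! ### Labeled reduction -/

theorem TraceStep.trans_intSteps {T U V : PMF Tm} {S : Trace} (h : TraceStep T S U)
    (hV : IntSteps U V) : TraceStep T S V := by
  induction hV with
  | refl => exact h
  | tail _ hstep ih => exact ih.internal hstep

theorem TraceStep.append {T U V : PMF Tm} {R S : Trace} (h : TraceStep T R U)
    (h' : TraceStep U S V) : TraceStep T (R ++ S) V := by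
  induction h' with
  | refl => simpa using h
  | internal _ hstep ih => exact ih.internal hstep
  | pass _ hl ih =>
    rw [← List.append_assoc]
    exact ih.pass hl

theorem IntSteps.traceStep {T U : PMF Tm} (h : IntSteps T U) : TraceStep T [] U :=
  (TraceStep.refl T).trans_intSteps h

theorem TraceStep.of_intSteps {T T' U V : PMF Tm} {S : Trace} (h : TraceStep T S U)
    (hT : IntSteps T T') (hV : IntSteps U V) (hn : IsNormalD V) : TraceStep T' S V := by
  induction h generalizing V with
  | refl => exact (hT.intSteps_of_isNormalD hV hn).traceStep
  | internal _ hstep ih => exact ih (hV.head hstep) hn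
  | pass _ hl ih => exact ((ih .refl hl.isNormalD).pass hl).trans_intSteps hV

theorem TraceStep.intSteps {T U : PMF Tm} (h : TraceStep T [] U) : IntSteps T U := by
  generalize hS : ([] : Trace) = S at h
  induction h with
  | refl => exact .refl
  | internal _ hstep ih => exact (ih hS).tail hstep
  | pass => simp at hS

theorem TraceStep.cons_pass {T U : PMF Tm} {S : Trace} {v : Tm}
    (h : TraceStep T (Act.pass v :: S) U) :
    ∃ L, IntSteps T L ∧ IsLamD L ∧ TraceStep (L.map (applyLam v)) S U := by
  generalize hR : Act.pass v :: S = R at h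
  induction h generalizing S with
  | refl => simp at hR
  | internal _ hstep ih =>
    obtain ⟨L, hL, hl, hS⟩ := ih hR
    exact ⟨L, hL, hl, hS.internal hstep⟩
  | @pass R L w h hl ih =>
    rcases List.cons_eq_append_iff.1 hR with ⟨rfl, hw⟩ | ⟨S', rfl, rfl⟩
    · obtain ⟨rfl, rfl⟩ : v = w ∧ S = [] := by simpa [eq_comm] using hw
      exact ⟨L, h.intSteps, hl, .refl _⟩
    · obtain ⟨L', hL', hl', hS⟩ := ih rfl
      exact ⟨L', hL', hl', hS.pass hl⟩

/-! ### Acceptance probabilities -/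

theorem traceAcc_iff_of_intSteps {T T' : PMF Tm} (h : IntSteps T T') (S : Trace) (p : ℝ) :
    TraceAcc T' S p ↔ TraceAcc T S p := by
  constructor
  · rintro ⟨hS, hs⟩
    exact .view (h.traceStep.append hS) hs
  · rintro ⟨hS, hs⟩
    exact .view (hS.of_intSteps h .refl hs.isNormalD) hs

theorem traceAcc_pass_iff {T T' : PMF Tm} {v : Tm} (h : TraceStep T [Act.pass v] T')
    (S : Trace) (p : ℝ) : TraceAcc T' S p ↔ TraceAcc T (Act.pass v :: S) p := by
  constructor
  · rintro ⟨hS, hs⟩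
    exact .view (h.append hS) hs
  · intro hacc
    obtain ⟨L, hL, hl, hLT⟩ := h.cons_pass
    rw [traceAcc_iff_of_intSteps hLT.intSteps]
    generalize hR : Act.pass v :: S = R at hacc
    obtain ⟨hS, hs⟩ := hacc
    rcases List.cons_eq_append_iff.1 hR with ⟨-, hw⟩ | ⟨S', rfl, rfl⟩
    · simp at hw
    · obtain ⟨L', hL', hl', hS'⟩ := hS.cons_pass
      obtain rfl := hL.unique hL' hl.isNormalD hl'.isNormalD
      exact .view hS' hs

theorem TraceAcc.exists_view {T : PMF Tm} {M : Finset BStr} {p : ℝ}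
    (h : TraceAcc T [Act.view M] p) :
    ∃ V, IntSteps T V ∧ IsStrD V ∧ p = (∑ m ∈ M, V (Tm.str m)).toReal := by
  generalize hR : [Act.view M] = R at h
  obtain ⟨hS, hs⟩ := h
  obtain ⟨rfl, hM⟩ := List.append_inj' (s₁ := []) hR rfl
  obtain rfl : M = _ := by simpa using hM
  exact ⟨_, hS.intSteps, hs, rfl⟩

theorem prT_congr {T U : PMF Tm} {R S : Trace} (h : ∀ p, TraceAcc T R p ↔ TraceAcc U S p) :
    prT T R = prT U S := by
  have hRS : TraceAcc T R = TraceAcc U S := funext fun p => propext (h p)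
  unfold prT
  rw [hRS]

theorem prT_view {T : PMF Tm} {M : Finset BStr} {p : ℝ} (h : TraceAcc T [Act.view M] p) :
    prT T [Act.view M] = p := by
  have hex : ∃ q, TraceAcc T [Act.view M] q := ⟨p, h⟩
  rw [prT, dif_pos hex]
  obtain ⟨V, hV, hVs, hVp⟩ := h.exists_view
  obtain ⟨W, hW, hWs, hWp⟩ := hex.choose_spec.exists_view
  rw [hVp, hWp, hV.unique hW hVs.isNormalD hWs.isNormalD]

theorem TraceAcc.mem_Icc {T : PMF Tm} {S : Trace} {p : ℝ} (h : TraceAcc T S p) :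
    p ∈ Set.Icc (0 : ℝ) 1 := by
  obtain @⟨S, V, M, -, -⟩ := h
  refine ⟨ENNReal.toReal_nonneg, ENNReal.toReal_le_of_le_ofReal zero_le_one ?_⟩
  have hinj : Function.Injective Tm.str := fun _ _ h => by injection h
  calc ∑ m ∈ M, V (Tm.str m) ≤ ∑' m, V (Tm.str m) := ENNReal.sum_le_tsum M
    _ ≤ ∑' t, V t := ENNReal.tsum_comp_le_tsum_of_injective hinj V
    _ = ENNReal.ofReal 1 := by rw [V.tsum_coe, ENNReal.ofReal_one]

theorem prT_mem_Icc (T : PMF Tm) (S : Trace) : prT T S ∈ Set.Icc (0 : ℝ) 1 := by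
  by_cases hex : ∃ p, TraceAcc T S p
  · rw [prT, dif_pos hex]
    exact hex.choose_spec.mem_Icc
  · rw [prT, dif_neg hex]
    exact ⟨le_rfl, zero_le_one⟩

theorem abs_prT_sub_le_tdist (T S : PMF Tm) (tr : Trace) :
    |prT T tr - prT S tr| ≤ tdist T S := by
  refine le_ciSup (f := fun tr => |prT T tr - prT S tr|) ⟨1, ?_⟩ tr
  rintro _ ⟨R, rfl⟩
  have hT := prT_mem_Icc T R
  have hS := prT_mem_Icc S R
  exact abs_le.2 ⟨by linarith [hT.1, hS.2], by linarith [hT.2, hS.1]⟩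

/-- **Trace Distance Properties.** Given `δ^T(T, S) = d`: internal
reduction preserves the distance, `pass`-actions do not increase it, and the
acceptance probabilities of any `view`-action differ by at most `d`. -/
theorem stmt14 (T S : PMF Tm) (d : ℝ) (h : tdist T S = d) :
    (∀ T' : PMF Tm, IntStep T T' → tdist T' S = d) ∧
      (∀ (v : Tm) (T' S' : PMF Tm),
        TraceStep T [Act.pass v] T' → TraceStep S [Act.pass v] S' → tdist T' S' ≤ d) ∧
      (∀ (M : Finset BStr) (p₁ p₂ : ℝ),
        TraceAcc T [Act.view M] p₁ → TraceAcc S [Act.view M] p₂ → |p₁ - p₂| ≤ d) := by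
  subst h
  refine ⟨fun T' hT => ?_, fun v T' S' hT hS => ?_, fun M p₁ p₂ h₁ h₂ => ?_⟩
  · simp only [tdist, prT_congr (traceAcc_iff_of_intSteps (.single hT) _)]
  · refine ciSup_le fun tr => ?_
    rw [prT_congr (traceAcc_pass_iff hT tr), prT_congr (traceAcc_pass_iff hS tr)]
    exact abs_prT_sub_le_tdist T S _
  · rw [← prT_view h₁, ← prT_view h₂]
    exact abs_prT_sub_le_tdist T S _
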